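/- arXiv:1804.08740 — 7 statements merged into one kernel-verified Lean document; each statement's English description precedes it below -/
import Mathlib

section
/- Let d ≥ 2 and let μ be a finite Borel measure on the unit sphere S^d ⊂ ℝ^{d+1} that is regular in the sense that μ({u ∈ S^d : ⟨u,e⟩ = 0}) = 0 for every e ∈ S^d. Let c = S^d ∩ ⋂_{i=1}^m {x ∈ ℝ^{d+1} : ⟨x, v_i⟩ ≤ 0} be a nonempty spherical polytope, where m ∈ ℕ and v_1, …, v_m ∈ ℝ^{d+1}. Then the set of all u ∈ S^d such that u^⊥ ∩ c ≠ ∅ and either ⟨u,x⟩ ≥ 0 for all x ∈ c or ⟨u,x⟩ ≤ 0 for all x ∈ c has μ-measure zero. (This is the first part of Lemma 2.2, expressed via the correspondence S = u^⊥ ∩ S^d between great hyperspheres and their poles: the great hypersphere u^⊥ ∩ S^d meets c but c lies entirely in one of the two closed half-spheres determined by it.) -/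
open MeasureTheory
open scoped RealInnerProductSpace

/-- A linear functional that is nonnegative on a polyhedral cone and vanishes at a point of the cone
vanishes at every point of the cone having the same active constraints. -/
theorem inner_eq_zero_of_same_active_constraints {E ι : Type*} [NormedAddCommGroup E]
    [InnerProductSpace ℝ E] [Finite ι] (v : ι → E) {u x y : E}
    (hu : ∀ z, (∀ i, ⟪z, v i⟫ ≤ 0) → 0 ≤ ⟪u, z⟫)
    (hx : ∀ i, ⟪x, v i⟫ ≤ 0) (hy : ∀ i, ⟪y, v i⟫ ≤ 0)
    (hact : ∀ i, ⟪x, v i⟫ = 0 → ⟪y, v i⟫ = 0) (hux : ⟪u, x⟫ = 0) : ⟪u, y⟫ = 0 := by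
  have hev : ∀ᶠ t : ℝ in nhdsWithin 0 (Set.Ioi 0), ∀ i, ⟪x - t • y, v i⟫ ≤ 0 := by
    refine Filter.eventually_all.2 fun i => ?_
    rcases (hx i).eq_or_lt with h | h
    · refine Filter.Eventually.of_forall fun t => ?_
      simp [inner_sub_left, real_inner_smul_left, h, hact i h]
    · have hcont : Continuous fun t : ℝ => ⟪x - t • y, v i⟫ := by fun_prop
      have hlt : ∀ᶠ t : ℝ in nhds 0, ⟪x - t • y, v i⟫ < 0 :=
        hcont.continuousAt.eventually_lt continuousAt_const (by simpa using h)
      exact (hlt.filter_mono nhdsWithin_le_nhds).mono fun t ht => ht.le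
  obtain ⟨t, ht, ht0⟩ := (hev.and self_mem_nhdsWithin).exists
  have ht0 : 0 < t := ht0
  have h := hu _ ht
  rw [inner_sub_right, hux, real_inner_smul_right] at h
  have hy_nonneg := hu y hy
  nlinarith

/-- A linear functional that is nonnegative on the unit vectors of a polyhedral cone is nonnegative
on the whole cone. -/
theorem inner_nonneg_of_nonneg_on_sphere {E ι : Type*} [NormedAddCommGroup E]
    [InnerProductSpace ℝ E] (v : ι → E) {u : E}
    (hu : ∀ z ∈ Metric.sphere (0 : E) 1, (∀ i, ⟪z, v i⟫ ≤ 0) → 0 ≤ ⟪u, z⟫)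
    (z : E) (hz : ∀ i, ⟪z, v i⟫ ≤ 0) : 0 ≤ ⟪u, z⟫ := by
  rcases eq_or_ne z 0 with rfl | h0
  · simp
  have hpos : 0 < ‖z‖⁻¹ := inv_pos.2 (norm_pos_iff.2 h0)
  have h := hu (‖z‖⁻¹ • z) (by simp [norm_smul, h0]) fun i => by
    rw [real_inner_smul_left]
    exact mul_nonpos_of_nonneg_of_nonpos hpos.le (hz i)
  rw [real_inner_smul_right] at h
  exact nonneg_of_mul_nonneg_right h hpos

/-- **Lemma 2.2, first part** (via poles of great hyperspheres).  Let `d ≥ 2` and let `μ` be a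
finite Borel measure on the unit sphere `S^d ⊂ ℝ^{d+1}` which is regular in the sense that
`μ {u ∈ S^d : ⟪u,e⟫ = 0} = 0` for every `e ∈ S^d`.  If
`c = S^d ∩ ⋂_{i} {x : ⟪x, v i⟫ ≤ 0}` is a nonempty spherical polytope, then the set of all
`u ∈ S^d` such that the great hypersphere `u^⊥ ∩ S^d` meets `c` while `c` lies entirely in one
of the two closed half-spheres `{⟪u,·⟫ ≥ 0}`, `{⟪u,·⟫ ≤ 0}` has `μ`-measure zero. -/
theorem measure_poles_touching_polytope_eq_zero
    (d m : ℕ) (hd : 2 ≤ d)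
    (μ : Measure (EuclideanSpace ℝ (Fin (d + 1)))) [IsFiniteMeasure μ]
    (hreg : ∀ e ∈ Metric.sphere (0 : EuclideanSpace ℝ (Fin (d + 1))) 1,
      μ {u | u ∈ Metric.sphere (0 : EuclideanSpace ℝ (Fin (d + 1))) 1 ∧ ⟪u, e⟫ = 0} = 0)
    (v : Fin m → EuclideanSpace ℝ (Fin (d + 1)))
    (c : Set (EuclideanSpace ℝ (Fin (d + 1))))
    (hc : c = Metric.sphere (0 : EuclideanSpace ℝ (Fin (d + 1))) 1 ∩
      ⋂ i, {x | ⟪x, v i⟫ ≤ 0})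
    (hne : c.Nonempty) :
    μ {u | u ∈ Metric.sphere (0 : EuclideanSpace ℝ (Fin (d + 1))) 1 ∧
        (∃ x ∈ c, ⟪u, x⟫ = 0) ∧
        ((∀ x ∈ c, 0 ≤ ⟪u, x⟫) ∨ (∀ x ∈ c, ⟪u, x⟫ ≤ 0))} = 0 := by
  have hmem : ∀ x, x ∈ c ↔
      x ∈ Metric.sphere (0 : EuclideanSpace ℝ (Fin (d + 1))) 1 ∧ ∀ i, ⟪x, v i⟫ ≤ 0 := by
    intro x
    simp [hc]
  let active : EuclideanSpace ℝ (Fin (d + 1)) → Set (Fin m) := fun x => {i | ⟪x, v i⟫ = 0}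
  have hrep : ∀ I : Set.image active c, ∃ e ∈ c, active e = I := fun I => I.2
  choose e hec heI using hrep
  refine measure_mono_null (t := ⋃ I : Set.image active c,
    {u | u ∈ Metric.sphere (0 : EuclideanSpace ℝ (Fin (d + 1))) 1 ∧ ⟪u, e I⟫ = 0}) ?_
    (measure_iUnion_null fun I => hreg (e I) ((hmem _).1 (hec I)).1)
  rintro u ⟨hu, ⟨x, hxc, hux⟩, hside⟩
  let I : Set.image active c := ⟨active x, x, hxc, rfl⟩
  refine Set.mem_iUnion.2 ⟨I, hu, ?_⟩
  have hx := ((hmem x).1 hxc).2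
  have he := ((hmem _).1 (hec I)).2
  have hact : ∀ i, ⟪x, v i⟫ = 0 → ⟪e I, v i⟫ = 0 := fun i hi =>
    (heI I).symm.subset (show i ∈ active x from hi)
  rcases hside with h | h
  · exact inner_eq_zero_of_same_active_constraints v
      (inner_nonneg_of_nonneg_on_sphere v fun z hz hzv => h z ((hmem z).2 ⟨hz, hzv⟩))
      hx he hact hux
  · have key : ⟪-u, e I⟫ = 0 := inner_eq_zero_of_same_active_constraints v
      (inner_nonneg_of_nonneg_on_sphere v fun z hz hzv => by
        simpa using h z ((hmem z).2 ⟨hz, hzv⟩))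
      hx he hact (by simpa using hux)
    simpa using key
end

section
/- Let d ≥ 2 and let C ⊆ S^d be an arbitrary compact set. Then the set of all u ∈ S^d such that u^⊥ ∩ C ≠ ∅ and either ⟨u,x⟩ ≥ 0 for all x ∈ C or ⟨u,x⟩ ≤ 0 for all x ∈ C is a null set for the d-dimensional Hausdorff measure H^d on S^d. (Consequently, this set is a null set for every Borel measure on S^d that is absolutely continuous with respect to H^d restricted to S^d; this is the second part of Lemma 2.2, expressed via poles u of great hyperspheres u^⊥ ∩ S^d.) -/
open MeasureTheory
open scoped RealInnerProductSpace

section TouchingHyperplanes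

variable {E : Type*} [NormedAddCommGroup E] [InnerProductSpace ℝ E]

/-- Radial projection to the unit sphere is `2`-Lipschitz outside the open unit ball. -/
theorem lipschitzOnWith_inv_norm_smul_self :
    LipschitzOnWith 2 (fun a : E => ‖a‖⁻¹ • a) {a | 1 ≤ ‖a‖} := by
  refine LipschitzOnWith.of_dist_le_mul fun a ha b hb => ?_
  have ha' : (1 : ℝ) ≤ ‖a‖ := ha
  have hb' : (1 : ℝ) ≤ ‖b‖ := hb
  have ha0 : ‖a‖ ≠ 0 := by positivity
  have hb0 : ‖b‖ ≠ 0 := by positivity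
  have key : ‖a‖⁻¹ • a - ‖b‖⁻¹ • b =
      ‖a‖⁻¹ • ((a - b) + ((‖b‖ - ‖a‖) * ‖b‖⁻¹) • b) := by
    rw [smul_add, smul_sub, smul_smul, sub_add, ← sub_smul]
    congr 2
    field_simp
    ring
  have hle : ‖(a - b) + ((‖b‖ - ‖a‖) * ‖b‖⁻¹) • b‖ ≤ 2 * ‖a - b‖ := by
    refine (norm_add_le _ _).trans ?_
    rw [norm_smul, norm_mul, norm_inv, norm_norm, mul_assoc, inv_mul_cancel₀ hb0, mul_one,
      Real.norm_eq_abs]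
    have := abs_norm_sub_norm_le b a
    rw [norm_sub_rev b a] at this
    linarith
  rw [dist_eq_norm, dist_eq_norm, key, norm_smul, norm_inv, norm_norm]
  calc ‖a‖⁻¹ * _ ≤ 1 * (2 * ‖a - b‖) :=
        mul_le_mul (inv_le_one_of_one_le₀ ha') hle (norm_nonneg _) zero_le_one
    _ = _ := by simp

variable (C : Set E)

/-- The unit poles of hyperplanes that meet `C` and have `C` in their nonnegative half-space. -/
def touchingPoles : Set E :=
  {u | ‖u‖ = 1 ∧ (∃ x ∈ C, ⟪u, x⟫ = 0) ∧ ∀ x ∈ C, 0 ≤ ⟪u, x⟫}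

variable {C}

/-- The affine section `e + eᗮ` of the dual cone of `C`. -/
def dualConeSection (C : Set E) (e : E) : Set (ℝ ∙ e)ᗮ :=
  {v | ∀ x ∈ C, 0 ≤ ⟪e + (v : E), x⟫}

theorem convex_dualConeSection (e : E) : Convex ℝ (dualConeSection C e) := by
  intro v hv w hw a b ha hb hab x hx
  have h1 := mul_nonneg ha (hv x hx)
  have h2 := mul_nonneg hb (hw x hx)
  have : ⟪e + ((a • v + b • w : (ℝ ∙ e)ᗮ) : E), x⟫ =
      a * ⟪e + (v : E), x⟫ + b * ⟪e + (w : E), x⟫ := by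
    simp only [Submodule.coe_add, Submodule.coe_smul, inner_add_left, real_inner_smul_left]
    linear_combination (-⟪e, x⟫) * hab
  rw [this]
  exact add_nonneg h1 h2

theorem mem_frontier_dualConeSection {e : E} (he : ‖e‖ = 1) {v : (ℝ ∙ e)ᗮ} {x : E}
    (hv : v ∈ dualConeSection C e) (hx : x ∈ C) (hx0 : x ≠ 0) (hvx : ⟪e + (v : E), x⟫ = 0) :
    v ∈ frontier (dualConeSection C e) := by
  refine ⟨subset_closure hv, fun hint => ?_⟩
  have hev : ⟪e, (v : E)⟫ = 0 := Submodule.mem_orthogonal_singleton_iff_inner_right.1 v.2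
  have hee : ⟪e, e⟫ = 1 := by rw [real_inner_self_eq_norm_sq, he, one_pow]
  let p : (ℝ ∙ e)ᗮ := ⟨x - ⟪e, x⟫ • e, by
    rw [Submodule.mem_orthogonal_singleton_iff_inner_right, inner_sub_right,
      real_inner_smul_right, hee]
    ring⟩
  have hxp : x = ⟪e, x⟫ • e + (p : E) := by simp [p]
  have hep : ⟪e, (p : E)⟫ = 0 := Submodule.mem_orthogonal_singleton_iff_inner_right.1 p.2
  have hp : p ≠ 0 := by
    intro h0
    have hx' : x = ⟪e, x⟫ • e := by rw [h0] at hxp; simpa using hxp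
    rw [hx', real_inner_smul_right, inner_add_left, hee, real_inner_comm e (v : E), hev, add_zero,
      mul_one] at hvx
    rw [hvx, zero_smul] at hx'
    exact hx0 hx'
  have hcont : Filter.Tendsto (fun t : ℝ => v - t • p) (nhdsWithin 0 (Set.Ioi 0)) (nhds v) := by
    have : Continuous fun t : ℝ => v - t • p := by fun_prop
    simpa using (this.tendsto 0).mono_left nhdsWithin_le_nhds
  obtain ⟨t, ht, ht0⟩ :=
    ((hcont.eventually (mem_interior_iff_mem_nhds.1 hint)).and self_mem_nhdsWithin).exists
  have h1 := ht x hx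
  have hpx : ⟪(p : E), x⟫ = ‖p‖ ^ 2 := by
    rw [hxp, inner_add_right, real_inner_smul_right, real_inner_comm e (p : E), hep,
      real_inner_self_eq_norm_sq]
    simp
  have h2 : ⟪e + ((v - t • p : (ℝ ∙ e)ᗮ) : E), x⟫ = ⟪e + (v : E), x⟫ - t * ‖p‖ ^ 2 := by
    rw [← hpx]
    simp only [Submodule.coe_sub, Submodule.coe_smul, inner_add_left, inner_sub_left,
      real_inner_smul_left]
    ring
  have h3 : 0 < t * ‖p‖ ^ 2 := mul_pos ht0 (by have := norm_pos_iff.2 hp; positivity)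
  linarith

theorem touchingPoles_inter_subset_image {e : E} (he : ‖e‖ = 1) (hC : (0 : E) ∉ C) :
    touchingPoles C ∩ {u | 0 < ⟪e, u⟫} ⊆
      (fun a : E => ‖a‖⁻¹ • a) ''
        ((fun v : (ℝ ∙ e)ᗮ => e + (v : E)) '' frontier (dualConeSection C e)) := by
  rintro u ⟨⟨hu, ⟨x, hx, hux⟩, hpos⟩, hue⟩
  have hue' : 0 < ⟪e, u⟫ := hue
  have hee : ⟪e, e⟫ = 1 := by rw [real_inner_self_eq_norm_sq, he, one_pow]
  let v : (ℝ ∙ e)ᗮ := ⟨⟪e, u⟫⁻¹ • u - e, by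
    rw [Submodule.mem_orthogonal_singleton_iff_inner_right, inner_sub_right,
      real_inner_smul_right, hee, inv_mul_cancel₀ hue'.ne', sub_self]⟩
  have hv : e + (v : E) = ⟪e, u⟫⁻¹ • u := by simp [v]
  refine ⟨_, ⟨v, mem_frontier_dualConeSection he (fun y hy => ?_) hx (fun h => hC (h ▸ hx)) ?_,
    rfl⟩, ?_⟩
  · rw [hv, real_inner_smul_left]
    exact mul_nonneg (inv_nonneg.2 hue'.le) (hpos y hy)
  · rw [hv, real_inner_smul_left, hux, mul_zero]
  · simp only [hv, norm_smul, hu, norm_inv, Real.norm_eq_abs, abs_of_pos hue', mul_one, inv_inv,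
      smul_smul, mul_inv_cancel₀ hue'.ne', one_smul]

variable [MeasurableSpace E] [BorelSpace E]

theorem hausdorffMeasure_touchingPoles_inter_eq_zero {d : ℕ}
    [Fact (Module.finrank ℝ E = d + 1)] {e : E} (he : ‖e‖ = 1) (hC : (0 : E) ∉ C) :
    μH[(d : ℝ)] (touchingPoles C ∩ {u | 0 < ⟪e, u⟫}) = 0 := by
  have : FiniteDimensional ℝ E := .of_fact_finrank_eq_succ d
  have he0 : e ≠ 0 := norm_ne_zero_iff.1 (by simp [he])
  have hrank : Module.finrank ℝ (ℝ ∙ e)ᗮ = d := Submodule.finrank_orthogonal_span_singleton he0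
  have hfront : μH[(d : ℝ)] (frontier (dualConeSection C e)) = 0 := by
    rw [← hrank]
    exact (convex_dualConeSection e).addHaar_frontier _
  refine measure_mono_null (touchingPoles_inter_subset_image he hC) ?_
  have hiso : Isometry fun v : (ℝ ∙ e)ᗮ => e + (v : E) :=
    (isometry_add_left e).comp isometry_subtype_coe
  have hsub : (fun v : (ℝ ∙ e)ᗮ => e + (v : E)) '' frontier (dualConeSection C e) ⊆
      {a | 1 ≤ ‖a‖} := by
    rintro _ ⟨v, -, rfl⟩
    have hev : ⟪e, (v : E)⟫ = 0 := Submodule.mem_orthogonal_singleton_iff_inner_right.1 v.2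
    have h := norm_add_sq_real e (v : E)
    rw [hev, he] at h
    have := sq_nonneg ‖(v : E)‖
    exact (one_le_sq_iff₀ (norm_nonneg _)).1 (by linarith)
  refine le_antisymm ((lipschitzOnWith_inv_norm_smul_self.mono hsub).hausdorffMeasure_image_le
    d.cast_nonneg |>.trans ?_) bot_le
  rw [hiso.hausdorffMeasure_image (Or.inl d.cast_nonneg), hfront, mul_zero]

theorem hausdorffMeasure_touchingPoles_eq_zero {d : ℕ}
    [Fact (Module.finrank ℝ E = d + 1)] (hC : (0 : E) ∉ C) :
    μH[(d : ℝ)] (touchingPoles C) = 0 := by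
  have : FiniteDimensional ℝ E := .of_fact_finrank_eq_succ d
  let b := stdOrthonormalBasis ℝ E
  refine measure_mono_null (t := ⋃ i, (touchingPoles C ∩ {u | 0 < ⟪b i, u⟫}) ∪
    (touchingPoles C ∩ {u | 0 < ⟪-b i, u⟫})) (fun u hu => ?_) ?_
  · have hu0 : u ≠ 0 := norm_ne_zero_iff.1 (by simp [hu.1])
    obtain ⟨i, hi⟩ : ∃ i, ⟪b i, u⟫ ≠ 0 := by
      by_contra! h
      exact hu0 (InnerProductSpace.ext_inner_left_basis b.toBasis fun i => by simpa using h i)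
    refine Set.mem_iUnion.2 ⟨i, ?_⟩
    rcases hi.lt_or_gt with h | h
    · exact Or.inr ⟨hu, by simpa [inner_neg_left] using h⟩
    · exact Or.inl ⟨hu, h⟩
  · refine measure_iUnion_null fun i => measure_union_null ?_ ?_
    · exact hausdorffMeasure_touchingPoles_inter_eq_zero (b.norm_eq_one i) hC
    · exact hausdorffMeasure_touchingPoles_inter_eq_zero
        ((norm_neg _).trans (b.norm_eq_one i)) hC

end TouchingHyperplanes

/-- **Lemma 2.2, second part** (via poles of great hyperspheres).  Let `d ≥ 2` and let
`C ⊆ S^d` be a compact set.  Then the set of all `u ∈ S^d` such that the great hypersphere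
`u^⊥ ∩ S^d` meets `C` while `C` lies entirely in one of the two closed half-spheres
`{⟪u,·⟫ ≥ 0}`, `{⟪u,·⟫ ≤ 0}` is a null set for the `d`-dimensional Hausdorff measure. -/
theorem hausdorff_measure_poles_touching_compact_eq_zero
    (d : ℕ) (hd : 2 ≤ d)
    (C : Set (EuclideanSpace ℝ (Fin (d + 1))))
    (hC : C ⊆ Metric.sphere (0 : EuclideanSpace ℝ (Fin (d + 1))) 1)
    (hcomp : IsCompact C) :
    (μH[(d : ℝ)] : Measure (EuclideanSpace ℝ (Fin (d + 1))))
      {u | u ∈ Metric.sphere (0 : EuclideanSpace ℝ (Fin (d + 1))) 1 ∧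
        (∃ x ∈ C, ⟪u, x⟫ = 0) ∧
        ((∀ x ∈ C, 0 ≤ ⟪u, x⟫) ∨ (∀ x ∈ C, ⟪u, x⟫ ≤ 0))} = 0 := by
  have : Fact (Module.finrank ℝ (EuclideanSpace ℝ (Fin (d + 1))) = d + 1) := ⟨by simp⟩
  have hC0 : (0 : EuclideanSpace ℝ (Fin (d + 1))) ∉ C := fun h => by simpa using hC h
  refine measure_mono_null (t := touchingPoles C ∪ touchingPoles (-C)) ?_
    (measure_union_null (hausdorffMeasure_touchingPoles_eq_zero hC0)
      (hausdorffMeasure_touchingPoles_eq_zero (by simpa using hC0)))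
  rintro u ⟨hu, ⟨x, hx, hux⟩, hpos | hneg⟩
  · exact Or.inl ⟨by simpa using hu, ⟨x, hx, hux⟩, hpos⟩
  · refine Or.inr ⟨by simpa using hu, ⟨-x, by simpa using hx, by simp [hux]⟩, fun y hy => ?_⟩
    simpa using hneg (-y) hy
end

section
/- For every t > 0, ∫_0^1 (1 − e^{−tz})/z dz = γ + ln t + E₁(t), where γ is the Euler–Mascheroni constant and E₁(t) = ∫_t^∞ s^{-1} e^{−s} ds is the exponential integral. (Via the variance formula, this evaluates the variance of the total length of the cell boundaries of an isotropic splitting tessellation on S²: Var H¹(Z_t) = 4π²(γ + ln t + E₁(t)).) -/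
open MeasureTheory Real

/-- The exponential integral `E₁(t) = ∫_t^∞ s⁻¹ e^{-s} ds`. -/
noncomputable def expIntegralE1 (t : ℝ) : ℝ := ∫ s in Set.Ioi t, s⁻¹ * Real.exp (-s)

open Filter Set in
/-- `log x * exp (-x)` is integrable on `(0, ∞)`, with integral `Γ'(1) = -γ`. -/
theorem integrableOn_log_mul_exp_neg_and_integral_eq :
    IntegrableOn (fun x : ℝ => Real.log x * Real.exp (-x)) (Ioi 0) ∧
      ∫ x in Ioi (0 : ℝ), Real.log x * Real.exp (-x) = -Real.eulerMascheroniConstant := by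
  have hmellin := mellin_hasDerivAt_of_isBigO_rpow (E := ℂ) (a := 2) (b := 0) (s := 1)
    (f := fun x => ((Real.exp (-x) : ℝ) : ℂ))
    (Continuous.locallyIntegrable (by fun_prop) |>.locallyIntegrableOn _)
    (by
      rw [← Asymptotics.isBigO_norm_left]
      simp_rw [Complex.norm_real, Asymptotics.isBigO_norm_left]
      simpa only [neg_one_mul] using (isLittleO_exp_neg_mul_rpow_atTop zero_lt_one _).isBigO)
    (by simp)
    (by
      simp_rw [neg_zero, Real.rpow_zero]
      refine Asymptotics.isBigO_const_of_tendsto (y := (1 : ℂ)) ?_ one_ne_zero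
      rw [(by simp : (1 : ℂ) = (Real.exp (-0) : ℝ))]
      exact (Continuous.continuousWithinAt (by fun_prop)))
    (by simp)
  have hint : IntegrableOn (fun x : ℝ => Real.log x * Real.exp (-x)) (Ioi 0) := by
    have h : IntegrableOn (fun x : ℝ => ((Real.log x * Real.exp (-x) : ℝ) : ℂ)) (Ioi 0) := by
      simpa [MellinConvergent] using hmellin.1
    exact h.re
  refine ⟨hint, ?_⟩
  have hderiv := Complex.hasDerivAt_GammaIntegral (s := 1) (by simp)
  have hGamma : Complex.Gamma =ᶠ[nhds 1] Complex.GammaIntegral := by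
    filter_upwards [(Complex.continuous_re.isOpen_preimage _ isOpen_Ioi).mem_nhds
      (show (1 : ℂ) ∈ Complex.re ⁻¹' Ioi 0 by simp)] with z hz
    exact Complex.Gamma_eq_integral hz
  have heq := (hderiv.congr_of_eventuallyEq hGamma).unique Complex.hasDerivAt_Gamma_one
  simp only [sub_self, Complex.cpow_zero, one_mul] at heq
  have hcast : ((∫ x in Ioi (0 : ℝ), Real.log x * Real.exp (-x) : ℝ) : ℂ)
      = ((-Real.eulerMascheroniConstant : ℝ) : ℂ) := by
    rw [← integral_complex_ofReal]
    push_cast at heq ⊢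
    exact heq
  exact_mod_cast hcast

/-- The function `(1 - exp (-x)) / x` is integrable near `0`. -/
theorem intervalIntegrable_one_sub_exp_neg_div {t : ℝ} (ht : 0 ≤ t) :
    IntervalIntegrable (fun x : ℝ => (1 - Real.exp (-x)) / x) volume 0 t := by
  refine (intervalIntegrable_const (c := (1 : ℝ))).mono_fun
    (Measurable.aestronglyMeasurable (by fun_prop)) ?_
  rw [Set.uIoc_of_le ht]
  filter_upwards [ae_restrict_mem measurableSet_Ioc] with x hx
  have h1 := Real.add_one_le_exp (-x)
  have h2 : Real.exp (-x) ≤ 1 := Real.exp_le_one_iff.mpr (by linarith [hx.1])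
  rw [Real.norm_of_nonneg (div_nonneg (by linarith) hx.1.le), norm_one, div_le_one hx.1]
  linarith

open Filter Set Topology in
/-- Integration by parts near the origin. -/
theorem integral_log_mul_exp_neg_zero_to {t : ℝ} (ht : 0 < t) :
    ∫ x in (0 : ℝ)..t, Real.log x * Real.exp (-x)
      = Real.log t * (1 - Real.exp (-t)) - ∫ x in (0 : ℝ)..t, (1 - Real.exp (-x)) / x := by
  have hlog : IntervalIntegrable (fun x : ℝ => Real.log x * Real.exp (-x)) volume 0 t :=
    intervalIntegral.intervalIntegrable_log'.mul_continuousOn (by fun_prop)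
  have hquot := intervalIntegrable_one_sub_exp_neg_div ht.le
  have hderiv : ∀ x ∈ Ioo 0 t, HasDerivAt (fun x => Real.log x * (1 - Real.exp (-x)))
      (Real.log x * Real.exp (-x) + (1 - Real.exp (-x)) / x) x := by
    intro x hx
    have h := (Real.hasDerivAt_log hx.1.ne').mul
      (((hasDerivAt_id x).neg.exp).const_sub 1)
    refine h.congr_deriv ?_
    simp only [id, Pi.neg_apply]
    ring
  have hzero : Tendsto (fun x => Real.log x * (1 - Real.exp (-x))) (𝓝[>] 0) (𝓝 0) := by
    have hbound : Tendsto (fun x : ℝ => ‖Real.log x * x‖) (𝓝[>] 0) (𝓝 0) := by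
      simpa using (tendsto_log_mul_rpow_nhdsGT_zero one_pos).norm
    refine squeeze_zero_norm' ?_ hbound
    filter_upwards [self_mem_nhdsWithin] with x (hx : 0 < x)
    have h1 := Real.add_one_le_exp (-x)
    have h2 : Real.exp (-x) ≤ 1 := Real.exp_le_one_iff.mpr (by linarith)
    rw [norm_mul, norm_mul, Real.norm_of_nonneg (by linarith : 0 ≤ 1 - Real.exp (-x)),
      Real.norm_of_nonneg hx.le]
    gcongr
    linarith
  have hend : Tendsto (fun x => Real.log x * (1 - Real.exp (-x))) (𝓝[<] t)
      (𝓝 (Real.log t * (1 - Real.exp (-t)))) :=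
    ((Real.continuousAt_log ht.ne').mul (by fun_prop)).tendsto.mono_left nhdsWithin_le_nhds
  have h := intervalIntegral.integral_eq_sub_of_hasDerivAt_of_tendsto ht hderiv
    (hlog.add hquot) hzero hend
  rw [intervalIntegral.integral_add hlog hquot] at h
  linarith

open Filter Set Topology in
/-- Integration by parts at infinity. -/
theorem integral_Ioi_log_mul_exp_neg {t : ℝ} (ht : 0 < t) :
    ∫ x in Ioi t, Real.log x * Real.exp (-x)
      = Real.log t * Real.exp (-t) + expIntegralE1 t := by
  have hlog : IntegrableOn (fun x : ℝ => Real.log x * Real.exp (-x)) (Ioi t) :=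
    integrableOn_log_mul_exp_neg_and_integral_eq.1.mono_set (Ioi_subset_Ioi ht.le)
  have hexp : IntegrableOn (fun x : ℝ => Real.exp (-x)) (Ioi t) := by
    simpa using exp_neg_integrableOn_Ioi t one_pos
  have hinv : IntegrableOn (fun x : ℝ => x⁻¹ * Real.exp (-x)) (Ioi t) := by
    refine (hexp.const_mul t⁻¹).mono' (Measurable.aestronglyMeasurable (by fun_prop)) ?_
    filter_upwards [ae_restrict_mem measurableSet_Ioi] with x (hx : t < x)
    have hx0 : 0 < x := ht.trans hx
    rw [Real.norm_of_nonneg (by positivity)]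
    gcongr
  have hderiv : ∀ x ∈ Ici t, HasDerivAt (fun x => -(Real.log x * Real.exp (-x)))
      (Real.log x * Real.exp (-x) - x⁻¹ * Real.exp (-x)) x := by
    intro x hx
    have h := ((Real.hasDerivAt_log (ht.trans_le hx).ne').mul (hasDerivAt_id x).neg.exp).neg
    refine h.congr_deriv ?_
    simp only [id, Pi.neg_apply]
    ring
  have htop : Tendsto (fun x => -(Real.log x * Real.exp (-x))) atTop (𝓝 0) := by
    have hbound : Tendsto (fun x : ℝ => x * Real.exp (-x)) atTop (𝓝 0) := by
      simpa using Real.tendsto_pow_mul_exp_neg_atTop_nhds_zero 1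
    refine squeeze_zero_norm' ?_ hbound
    filter_upwards [eventually_ge_atTop 1] with x hx
    rw [norm_neg, norm_mul, Real.norm_of_nonneg (Real.log_nonneg hx),
      Real.norm_of_nonneg (Real.exp_pos _).le]
    gcongr
    exact Real.log_le_self (by linarith)
  have h := integral_Ioi_of_hasDerivAt_of_tendsto' hderiv (hlog.sub hinv) htop
  rw [integral_sub hlog hinv] at h
  rw [expIntegralE1]
  linarith

/-- For every `t > 0`, `∫_0^1 (1 - e^{-tz})/z dz = γ + ln t + E₁(t)`, where `γ` is the
Euler–Mascheroni constant and `E₁` is the exponential integral. -/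
theorem integral_one_sub_exp_div_eq_eulerMascheroni_add_log_add_E1 (t : ℝ) (ht : 0 < t) :
    ∫ z in (0:ℝ)..1, (1 - Real.exp (-(t * z))) / z
      = Real.eulerMascheroniConstant + Real.log t + expIntegralE1 t := by
  have hscale : ∫ z in (0:ℝ)..1, (1 - Real.exp (-(t * z))) / z
      = ∫ x in (0:ℝ)..t, (1 - Real.exp (-x)) / x := by
    have h := intervalIntegral.smul_integral_comp_mul_left (a := 0) (b := 1)
      (fun x : ℝ => (1 - Real.exp (-x)) / x) t
    rw [mul_zero, mul_one, smul_eq_mul, ← intervalIntegral.integral_const_mul] at h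
    rw [← h]
    congr 1 with z
    rw [← mul_div_assoc, mul_div_mul_left _ _ ht.ne']
  obtain ⟨hint, hgamma⟩ := integrableOn_log_mul_exp_neg_and_integral_eq
  have hsplit := intervalIntegral.integral_interval_add_Ioi hint
    (hint.mono_set (Set.Ioi_subset_Ioi ht.le))
  rw [integral_log_mul_exp_neg_zero_to ht, integral_Ioi_log_mul_exp_neg ht, hgamma] at hsplit
  rw [hscale]
  linarith
end

section
/- The variance of the total length of the cell boundaries of an isotropic splitting tessellation on S², given explicitly by Var H¹(Z_t) = 4π²(γ + ln t + E₁(t)), is asymptotically equivalent to 4π² ln t as t → ∞; that is, lim_{t→∞} (γ + ln t + E₁(t)) / ln t = 1, where γ is the Euler–Mascheroni constant and E₁(t) = ∫_t^∞ s^{-1} e^{−s} ds. In particular, this variance tends to infinity as t → ∞. -/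
open MeasureTheory Real Filter

theorem expIntegralE1_nonneg {t : ℝ} (ht : 0 ≤ t) : 0 ≤ expIntegralE1 t :=
  setIntegral_nonneg measurableSet_Ioi fun _ hs =>
    mul_nonneg (inv_nonneg.2 (ht.trans (Set.mem_Ioi.1 hs).le)) (Real.exp_pos _).le

theorem expIntegralE1_le_exp_neg {t : ℝ} (ht : 1 ≤ t) : expIntegralE1 t ≤ Real.exp (-t) := by
  rw [← integral_exp_neg_Ioi t]
  refine integral_mono_of_nonneg ?_ (integrableOn_exp_neg_Ioi t) ?_
  · filter_upwards [ae_restrict_mem measurableSet_Ioi] with s hs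
    have hs' : t < s := hs
    have : 0 < s := by linarith
    simp only [Pi.zero_apply]
    positivity
  · filter_upwards [ae_restrict_mem measurableSet_Ioi] with s hs
    have hs' : t < s := hs
    exact mul_le_of_le_one_left (Real.exp_pos _).le (inv_le_one_of_one_le₀ (by linarith))

theorem tendsto_expIntegralE1_atTop : Tendsto expIntegralE1 atTop (nhds 0) := by
  refine tendsto_of_tendsto_of_tendsto_of_le_of_le' tendsto_const_nhds
    Real.tendsto_exp_neg_atTop_nhds_zero ?_ ?_
  · filter_upwards [eventually_ge_atTop 0] with t ht using expIntegralE1_nonneg ht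
  · filter_upwards [eventually_ge_atTop 1] with t ht using expIntegralE1_le_exp_neg ht

/-- The variance `Var H¹(Z_t) = 4π²(γ + ln t + E₁(t))` of the total length of the cell
boundaries of an isotropic splitting tessellation on `S²` is asymptotically equivalent to
`4π² ln t` as `t → ∞`, i.e. `(γ + ln t + E₁(t))/ln t → 1`; in particular it tends to `∞`. -/
theorem variance_asymptotics_S2 :
    Tendsto (fun t : ℝ =>
        (Real.eulerMascheroniConstant + Real.log t + expIntegralE1 t) / Real.log t)
      atTop (nhds 1)
    ∧ Tendsto (fun t : ℝ =>
        4 * Real.pi ^ 2 * (Real.eulerMascheroniConstant + Real.log t + expIntegralE1 t))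
      atTop atTop := by
  constructor
  · have h := ((tendsto_expIntegralE1_atTop.const_add Real.eulerMascheroniConstant).div_atTop
      Real.tendsto_log_atTop).const_add 1
    rw [add_zero] at h
    refine h.congr' ?_
    filter_upwards [eventually_gt_atTop 1] with t ht
    have : Real.log t ≠ 0 := (Real.log_pos ht).ne'
    field_simp
    ring
  · exact ((tendsto_atTop_add_const_left _ _ Real.tendsto_log_atTop).atTop_add
      tendsto_expIntegralE1_atTop).const_mul_atTop (by positivity)
end

section
/- For every integer d ≥ 3 and every t ≥ 0, ∫_0^1 sin(πz)^{d−2} · (1 − e^{−tz}) / z dz ≤ π ∫_0^1 sin(πz)^{d−3} dz < ∞. In particular, the function t ↦ (2π)^d/(d−2)! · ∫_0^1 sin(πz)^{d−2} (1 − e^{−tz})/z dz, which equals the variance Var H^{d−1}(Z_t) of the total surface area of the cell boundaries of an isotropic splitting tessellation on S^d, is bounded uniformly in t ≥ 0 when d ≥ 3. -/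
open MeasureTheory Real

/-- The integrand is dominated on `(0, 1]` because `sin x ≤ x` and `1 - e^{-s} ≤ 1`. -/
lemma sin_pow_mul_one_sub_exp_div_mem_Icc (n : ℕ) {t z : ℝ} (ht : 0 ≤ t)
    (hz : z ∈ Set.Ioc (0 : ℝ) 1) :
    sin (π * z) ^ (n + 1) * (1 - exp (-(t * z))) / z ∈ Set.Icc 0 (π * sin (π * z) ^ n) := by
  obtain ⟨hz0, hz1⟩ := hz
  have hπz : 0 ≤ π * z := by positivity
  have hsin : 0 ≤ sin (π * z) :=
    sin_nonneg_of_nonneg_of_le_pi hπz (mul_le_of_le_one_right pi_pos.le hz1)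
  have hexp : 0 ≤ 1 - exp (-(t * z)) :=
    sub_nonneg.2 (exp_le_one_iff.2 (neg_nonpos.2 (by positivity)))
  refine ⟨by positivity, (div_le_iff₀ hz0).2 ?_⟩
  calc sin (π * z) ^ (n + 1) * (1 - exp (-(t * z)))
      ≤ sin (π * z) ^ (n + 1) * 1 := by
        gcongr
        exact sub_le_self _ (exp_pos _).le
    _ = sin (π * z) ^ n * sin (π * z) := by ring
    _ ≤ sin (π * z) ^ n * (π * z) := by
        gcongr
        exact sin_le hπz
    _ = π * sin (π * z) ^ n * z := by ring

lemma integral_sin_pow_mul_one_sub_exp_div_le (n : ℕ) {t : ℝ} (ht : 0 ≤ t) :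
    (∫ z in (0 : ℝ)..1, sin (π * z) ^ (n + 1) * (1 - exp (-(t * z))) / z)
      ≤ π * ∫ z in (0 : ℝ)..1, sin (π * z) ^ n := by
  rw [← intervalIntegral.integral_const_mul, intervalIntegral.integral_of_le zero_le_one,
    intervalIntegral.integral_of_le zero_le_one]
  have hint : IntervalIntegrable (fun z ↦ π * sin (π * z) ^ n) volume 0 1 :=
    Continuous.intervalIntegrable (by fun_prop) 0 1
  refine integral_mono_of_nonneg ?_ hint.1 ?_ <;>
    refine ae_restrict_of_forall_mem measurableSet_Ioc fun z hz ↦ ?_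
  · exact (sin_pow_mul_one_sub_exp_div_mem_Icc n ht hz).1
  · exact (sin_pow_mul_one_sub_exp_div_mem_Icc n ht hz).2

/-- For `d ≥ 3` and `t ≥ 0`,
`∫_0^1 sin(πz)^{d-2}(1 - e^{-tz})/z dz ≤ π ∫_0^1 sin(πz)^{d-3} dz`; in particular the
variance `Var H^{d-1}(Z_t) = (2π)^d/(d-2)! ∫_0^1 sin(πz)^{d-2}(1-e^{-tz})/z dz` of the total
surface area of the cell boundaries of an isotropic splitting tessellation on `S^d` is
bounded uniformly in `t ≥ 0`. -/
theorem variance_bounded_in_time (d : ℕ) (hd : 3 ≤ d) :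
    (∀ t : ℝ, 0 ≤ t →
        (∫ z in (0:ℝ)..1, Real.sin (Real.pi * z) ^ (d - 2) * (1 - Real.exp (-(t * z))) / z)
          ≤ Real.pi * ∫ z in (0:ℝ)..1, Real.sin (Real.pi * z) ^ (d - 3))
    ∧ ∃ C : ℝ, ∀ t : ℝ, 0 ≤ t →
        (2 * Real.pi) ^ d / (Nat.factorial (d - 2)) *
            (∫ z in (0:ℝ)..1, Real.sin (Real.pi * z) ^ (d - 2) * (1 - Real.exp (-(t * z))) / z)
          ≤ C := by
  obtain ⟨n, rfl⟩ := Nat.exists_eq_add_of_le' hd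
  have hbound : ∀ t : ℝ, 0 ≤ t → _ :=
    fun t ht ↦ integral_sin_pow_mul_one_sub_exp_div_le n (t := t) ht
  exact ⟨hbound, _, fun t ht ↦ mul_le_mul_of_nonneg_left (hbound t ht) (by positivity)⟩
end

section
/- For every fixed t ≥ 0, lim_{d→∞} (2π)^d / (d−2)! · ∫_0^1 sin(πz)^{d−2} (1 − e^{−tz}) / z dz = 0; that is, the variance Var H^{d−1}(Z_t) of the total surface area of the cell boundaries of an isotropic splitting tessellation on S^d with fixed time parameter t tends to zero as the dimension d tends to infinity. -/
open MeasureTheory Real Filter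

/-- The integrand is bounded by `t` on `(0, 1]`, uniformly in the exponent. -/
lemma norm_integral_sin_pow_mul_one_sub_exp_div_le {t : ℝ} (ht : 0 ≤ t) (n : ℕ) :
    ‖∫ z in (0:ℝ)..1, Real.sin (Real.pi * z) ^ n * (1 - Real.exp (-(t * z))) / z‖ ≤ t := by
  refine (intervalIntegral.norm_integral_le_of_norm_le_const (C := t) fun z hz ↦ ?_).trans_eq
    (by simp)
  rw [Set.uIoc_of_le zero_le_one] at hz
  have hz0 : 0 < z := hz.1
  have hexp : Real.exp (-(t * z)) ≤ 1 := Real.exp_le_one_iff.2 (by nlinarith)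
  have hlin : 1 - Real.exp (-(t * z)) ≤ t * z := by
    linarith [Real.add_one_le_exp (-(t * z))]
  have hsin : |Real.sin (Real.pi * z)| ^ n ≤ 1 :=
    pow_le_one₀ (abs_nonneg _) (Real.abs_sin_le_one _)
  rw [norm_div, norm_mul, norm_pow, Real.norm_eq_abs, Real.norm_eq_abs, Real.norm_eq_abs,
    abs_of_pos hz0, abs_of_nonneg (sub_nonneg.2 hexp), div_le_iff₀ hz0]
  calc |Real.sin (Real.pi * z)| ^ n * (1 - Real.exp (-(t * z)))
      ≤ 1 * (1 - Real.exp (-(t * z))) :=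
        mul_le_mul_of_nonneg_right hsin (sub_nonneg.2 hexp)
    _ ≤ t * z := by rwa [one_mul]

/-- For every fixed `t ≥ 0`, the variance
`Var H^{d-1}(Z_t) = (2π)^d/(d-2)! ∫_0^1 sin(πz)^{d-2}(1 - e^{-tz})/z dz` of the total surface
area of the cell boundaries of an isotropic splitting tessellation on `S^d` tends to `0` as
the dimension `d` tends to infinity. -/
theorem variance_tendsto_zero_in_dimension (t : ℝ) (ht : 0 ≤ t) :
    Tendsto (fun d : ℕ =>
        (2 * Real.pi) ^ d / (Nat.factorial (d - 2)) *
          ∫ z in (0:ℝ)..1, Real.sin (Real.pi * z) ^ (d - 2) * (1 - Real.exp (-(t * z))) / z)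
      atTop (nhds 0) := by
  rw [← tendsto_add_atTop_iff_nat 2]
  have hlim : Tendsto (fun n : ℕ ↦ (2 * Real.pi) ^ n / (Nat.factorial n) * ((2 * Real.pi) ^ 2 * t))
      atTop (nhds 0) := by
    simpa using (FloorSemiring.tendsto_pow_div_factorial_atTop (2 * Real.pi)).mul_const
      ((2 * Real.pi) ^ 2 * t)
  refine squeeze_zero_norm (fun n ↦ ?_) hlim
  rw [Nat.add_sub_cancel, norm_mul, Real.norm_of_nonneg (by positivity)]
  refine (mul_le_mul_of_nonneg_left (norm_integral_sin_pow_mul_one_sub_exp_div_le ht n)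
    (by positivity)).trans_eq ?_
  ring
end

section
/- Let d ≥ 2 be an integer, and for t > 0 set L(t) := (d/(d−1)) · 2π t^{d−1} / (2t^d + d ∫_0^t s^{d−2} e^{−s} ds) and L̄(t) := 2π / (2t + e^{−t}). Then for every t > 0: 1 ≤ L(t)/L̄(t), (d/(d−1)) · (1 + e^{−t}/(2t)) / (1 + (d/(d−1)) · 1/(2t)) ≤ L(t)/L̄(t), and L(t)/L̄(t) ≤ (d/(d−1)) · (1 + e^{−t}/(2t)) / (1 + (d/(d−1)) · e^{−t}/(2t)). In particular L̄(t) ≤ L(t), and for fixed t > 0 the ratio L(t)/L̄(t) tends to 1 as d → ∞. -/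
open MeasureTheory Real Filter

/-- The expected length of the typical maximal spherical segment of a splitting tessellation
on `S^d` at time `t`:  `L(t) = (d/(d-1)) · 2π t^{d-1} / (2t^d + d·γ(d-1,t))`, where
`γ(d-1,t) = ∫_0^t s^{d-2} e^{-s} ds` is the lower incomplete gamma function. -/
noncomputable def typMaxSegLength (d : ℕ) (t : ℝ) : ℝ :=
  ((d : ℝ) / ((d : ℝ) - 1)) * (2 * Real.pi * t ^ (d - 1)) /
    (2 * t ^ d + d * ∫ s in (0:ℝ)..t, s ^ (d - 2) * Real.exp (-s))

/-- The expected length of the typical edge of a Poisson great hypersphere tessellation on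
`S^d` at time `t`:  `L̄(t) = 2π/(2t + e^{-t})`. -/
noncomputable def typEdgeLength (t : ℝ) : ℝ := 2 * Real.pi / (2 * t + Real.exp (-t))

theorem intervalIntegrable_pow_mul_exp_neg (m : ℕ) (a b : ℝ) :
    IntervalIntegrable (fun s : ℝ => s ^ m * Real.exp (-s)) volume a b :=
  Continuous.intervalIntegrable (by fun_prop) a b

theorem integral_pow_mul_exp_neg_nonneg (m : ℕ) {t : ℝ} (ht : 0 ≤ t) :
    0 ≤ ∫ s in (0:ℝ)..t, s ^ m * Real.exp (-s) :=
  intervalIntegral.integral_nonneg ht fun _ hs =>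
    mul_nonneg (pow_nonneg hs.1 m) (Real.exp_pos _).le

theorem integral_pow_mul_exp_neg_le (m : ℕ) {t : ℝ} (ht : 0 ≤ t) :
    (m + 1) * ∫ s in (0:ℝ)..t, s ^ m * Real.exp (-s) ≤ t ^ (m + 1) := by
  have h : ∫ s in (0:ℝ)..t, s ^ m * Real.exp (-s) ≤ ∫ s in (0:ℝ)..t, s ^ m := by
    refine intervalIntegral.integral_mono_on ht (intervalIntegrable_pow_mul_exp_neg m 0 t)
      (Continuous.intervalIntegrable (by fun_prop) 0 t) fun s hs => ?_
    exact mul_le_of_le_one_right (pow_nonneg hs.1 m) (Real.exp_le_one_iff.2 (by linarith [hs.1]))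
  rw [integral_pow, zero_pow m.succ_ne_zero, sub_zero, le_div_iff₀ (by positivity)] at h
  linarith

/-- The recurrence of the lower incomplete gamma function at positive integers. -/
theorem integral_pow_succ_mul_exp_neg (m : ℕ) (t : ℝ) :
    (m + 1) * ∫ s in (0:ℝ)..t, s ^ m * Real.exp (-s) =
      t ^ (m + 1) * Real.exp (-t) + ∫ s in (0:ℝ)..t, s ^ (m + 1) * Real.exp (-s) := by
  have hderiv (s : ℝ) : HasDerivAt (fun s : ℝ => s ^ (m + 1) * Real.exp (-s))
      ((m + 1) * (s ^ m * Real.exp (-s)) - s ^ (m + 1) * Real.exp (-s)) s := by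
    refine ((hasDerivAt_pow (m + 1) s).mul (hasDerivAt_neg s).exp).congr_deriv ?_
    rw [Nat.add_sub_cancel]
    push_cast
    ring
  have h := intervalIntegral.integral_eq_sub_of_hasDerivAt (a := 0) (b := t)
    (fun s _ => hderiv s) (Continuous.intervalIntegrable (by fun_prop) 0 t)
  rw [intervalIntegral.integral_sub
      ((intervalIntegrable_pow_mul_exp_neg m 0 t).const_mul _)
      (intervalIntegrable_pow_mul_exp_neg (m + 1) 0 t),
    intervalIntegral.integral_const_mul, zero_pow m.succ_ne_zero, zero_mul, sub_zero] at h
  linarith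

/-- The length ratio in terms of the normalized incomplete gamma function
`j = (d-1) γ(d-1,t) / t^(d-1)`. -/
theorem exists_typMaxSegLength_div_typEdgeLength_eq (d : ℕ) (hd : 2 ≤ d) (t : ℝ) (ht : 0 < t) :
    ∃ j : ℝ, Real.exp (-t) ≤ j ∧ j ≤ 1 ∧ d * (j - Real.exp (-t)) ≤ t ∧
      typMaxSegLength d t / typEdgeLength t =
        ((d : ℝ) / ((d : ℝ) - 1)) * (1 + Real.exp (-t) / (2 * t)) /
          (1 + ((d : ℝ) / ((d : ℝ) - 1)) * (j / (2 * t))) := by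
  obtain ⟨m, rfl⟩ := Nat.exists_eq_add_of_le' hd
  have hrec := integral_pow_succ_mul_exp_neg m t
  have hle := integral_pow_mul_exp_neg_le m ht.le
  have hle' := integral_pow_mul_exp_neg_le (m + 1) ht.le
  have hnonneg := integral_pow_mul_exp_neg_nonneg (m + 1) ht.le
  have hI := integral_pow_mul_exp_neg_nonneg m ht.le
  have hp : 0 < t ^ (m + 1) := pow_pos ht _
  have he := Real.exp_pos (-t)
  unfold typMaxSegLength typEdgeLength
  rw [show m + 2 - 1 = m + 1 by omega, show m + 2 - 2 = m by omega]
  push_cast at hle' ⊢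
  set I := ∫ s in (0:ℝ)..t, s ^ m * Real.exp (-s)
  set I' := ∫ s in (0:ℝ)..t, s ^ (m + 1) * Real.exp (-s)
  refine ⟨(m + 1) * I / t ^ (m + 1), ?_, ?_, ?_, ?_⟩
  · rw [le_div_iff₀ hp]
    linarith
  · rwa [div_le_one hp]
  · rw [hrec, add_div, mul_div_cancel_left₀ _ hp.ne', add_sub_cancel_left, ← mul_div_assoc,
      div_le_iff₀ hp]
    linarith [pow_succ' t (m + 1)]
  · have hm : (m : ℝ) + 2 - 1 = m + 1 := by ring
    rw [hm, pow_succ' t (m + 1)]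
    have hpi := Real.pi_pos
    have h1 : 2 * (t * t ^ (m + 1)) + ((m : ℝ) + 2) * I ≠ 0 := by positivity
    have h2 : 1 + ((m : ℝ) + 2) / (m + 1) * ((m + 1) * I / t ^ (m + 1) / (2 * t)) ≠ 0 := by
      positivity
    generalize t ^ (m + 1) = p at *
    rw [div_div_eq_mul_div, div_eq_div_iff (by positivity) h2, div_mul_eq_mul_div]
    field_simp

/-- For `d ≥ 2` and `t > 0` one has `1 ≤ L(t)/L̄(t)`, together with the lower bound
`(d/(d-1))·(1 + e^{-t}/(2t))/(1 + (d/(d-1))·(1/(2t))) ≤ L(t)/L̄(t)` and the upper bound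
`L(t)/L̄(t) ≤ (d/(d-1))·(1 + e^{-t}/(2t))/(1 + (d/(d-1))·(e^{-t}/(2t)))`.
In particular `L̄(t) ≤ L(t)`, and for fixed `t > 0` the ratio tends to `1` as `d → ∞`. -/
theorem typMaxSegLength_div_typEdgeLength_bounds (d : ℕ) (hd : 2 ≤ d) (t : ℝ) (ht : 0 < t) :
    (1 ≤ typMaxSegLength d t / typEdgeLength t)
    ∧ ((d : ℝ) / ((d : ℝ) - 1)) * (1 + Real.exp (-t) / (2 * t)) /
          (1 + ((d : ℝ) / ((d : ℝ) - 1)) * (1 / (2 * t)))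
        ≤ typMaxSegLength d t / typEdgeLength t
    ∧ typMaxSegLength d t / typEdgeLength t
        ≤ ((d : ℝ) / ((d : ℝ) - 1)) * (1 + Real.exp (-t) / (2 * t)) /
            (1 + ((d : ℝ) / ((d : ℝ) - 1)) * (Real.exp (-t) / (2 * t)))
    ∧ typEdgeLength t ≤ typMaxSegLength d t
    ∧ Tendsto (fun d : ℕ => typMaxSegLength d t / typEdgeLength t) atTop (nhds 1) := by
  have hlower (n : ℕ) (hn : 2 ≤ n) : 1 ≤ typMaxSegLength n t / typEdgeLength t := by
    obtain ⟨j, hej, -, hj, heq⟩ := exists_typMaxSegLength_div_typEdgeLength_eq n hn t ht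
    have hn1 : (0 : ℝ) < n - 1 := by
      have : (2 : ℝ) ≤ n := by exact_mod_cast hn
      linarith
    have hj0 : 0 < j := (Real.exp_pos _).trans_le hej
    rw [heq, one_le_div (by positivity)]
    have : (n : ℝ) / (n - 1) * (1 + Real.exp (-t) / (2 * t)) - (1 + n / (n - 1) * (j / (2 * t)))
        = (2 * t - n * (j - Real.exp (-t))) / ((n - 1) * (2 * t)) := by
      field_simp
      ring
    have : 0 ≤ (2 * t - n * (j - Real.exp (-t))) / ((n - 1) * (2 * t)) :=
      div_nonneg (by linarith) (by positivity)
    linarith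
  have hupper (n : ℕ) (hn : 2 ≤ n) : typMaxSegLength n t / typEdgeLength t ≤
      ((n : ℝ) / ((n : ℝ) - 1)) * (1 + Real.exp (-t) / (2 * t)) /
        (1 + ((n : ℝ) / ((n : ℝ) - 1)) * (Real.exp (-t) / (2 * t))) := by
    obtain ⟨j, hej, -, -, heq⟩ := exists_typMaxSegLength_div_typEdgeLength_eq n hn t ht
    have hn1 : (0 : ℝ) < n - 1 := by
      have : (2 : ℝ) ≤ n := by exact_mod_cast hn
      linarith
    rw [heq]
    gcongr
  refine ⟨hlower d hd, ?_, hupper d hd, ?_, ?_⟩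
  · obtain ⟨j, hej, hj1, -, heq⟩ := exists_typMaxSegLength_div_typEdgeLength_eq d hd t ht
    have hd1 : (0 : ℝ) < d - 1 := by
      have : (2 : ℝ) ≤ d := by exact_mod_cast hd
      linarith
    have hj0 : 0 < j := (Real.exp_pos _).trans_le hej
    rw [heq]
    gcongr
  · have hpos : 0 < typEdgeLength t := by
      unfold typEdgeLength
      positivity
    exact (one_le_div hpos).1 (hlower d hd)
  · have hc : Tendsto (fun n : ℕ => (n : ℝ) / ((n : ℝ) - 1)) atTop (nhds 1) := by
      simpa [sub_eq_add_neg] using tendsto_natCast_div_add_atTop (-1 : ℝ)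
    have hne : 1 + 1 * (Real.exp (-t) / (2 * t)) ≠ 0 := by positivity
    have hlim := (hc.mul_const (1 + Real.exp (-t) / (2 * t))).div
      ((hc.mul_const (Real.exp (-t) / (2 * t))).const_add 1) hne
    rw [one_mul, one_mul, div_self (by simpa using hne)] at hlim
    refine tendsto_of_tendsto_of_tendsto_of_le_of_le' tendsto_const_nhds hlim ?_ ?_
    · filter_upwards [eventually_ge_atTop 2] with n hn using hlower n hn
    · filter_upwards [eventually_ge_atTop 2] with n hn using hupper n hn
end
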